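/- arXiv:2510.19411 — 3 statements merged into one kernel-verified Lean document; each statement's English description precedes it below -/
import Mathlib

section
/- For every d ≥ 3, if a graph G has a d-cycle double cover, then the (d−1)-dimensional flow number of G satisfies φ_{d−1}(G) ≤ 1 + √(d/(d−2)). -/
open scoped BigOperators

/-- `Hd d` : vectors in `ℝ^d` with exactly one coordinate `1`, one `-1`, rest `0`. -/
def Hd (d : ℕ) : Set (EuclideanSpace ℝ (Fin d)) :=
  {x | ∃ i j : Fin d, i ≠ j ∧ x i = 1 ∧ x j = -1 ∧ ∀ k, k ≠ i → k ≠ j → x k = 0}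
/-- A flow on a graph, represented as an antisymmetric function on ordered pairs of vertices,
supported on edges, with conservation at every vertex. -/
def IsFlow {V : Type*} [Fintype V] {d : ℕ} (G : SimpleGraph V)
    (f : V → V → EuclideanSpace ℝ (Fin d)) : Prop :=
  (∀ u v, f u v = - f v u) ∧ (∀ u v, ¬ G.Adj u v → f u v = 0) ∧ (∀ v, ∑ u, f v u = 0)

/-- `G` admits a flow with all edge values in the (symmetric) set `X`. -/
def HasFlowIn {V : Type*} [Fintype V] {d : ℕ} (G : SimpleGraph V)
    (X : Set (EuclideanSpace ℝ (Fin d))) : Prop :=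
  ∃ f, IsFlow G f ∧ ∀ u v, G.Adj u v → f u v ∈ X
/-- An (unoriented) `d`-cycle double cover: `d` even subgraphs (symmetric Boolean edge
indicators with all degrees even) such that every edge of `G` lies in exactly two of them. -/
def IsCDC {V : Type*} [Fintype V] [DecidableEq V] (G : SimpleGraph V) {d : ℕ}
    (c : Fin d → V → V → Bool) : Prop :=
  (∀ i u v, c i u v = c i v u) ∧
  (∀ i u v, c i u v = true → G.Adj u v) ∧
  (∀ i v, Even (Finset.univ.filter (fun u => c i v u = true)).card) ∧
  (∀ u v, G.Adj u v → (Finset.univ.filter (fun i : Fin d => c i u v = true)).card = 2)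
/-- `G` admits an `(r, d)`-NZF: a flow into `ℝ^d` with all edge values of norm in `[1, r-1]`. -/
def HasNZF {V : Type*} [Fintype V] (G : SimpleGraph V) (r : ℝ) (d : ℕ) : Prop :=
  ∃ f : V → V → EuclideanSpace ℝ (Fin d), IsFlow G f ∧
    ∀ u v, G.Adj u v → ‖f u v‖ ∈ Set.Icc (1 : ℝ) (r - 1)

/-- The `d`-dimensional flow number: the infimum of `r ≥ 2` such that `G` has an `(r,d)`-NZF. -/
noncomputable def flowNumber {V : Type*} [Fintype V] (G : SimpleGraph V) (d : ℕ) : ℝ :=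
  sInf {r : ℝ | 2 ≤ r ∧ HasNZF G r d}

/-- The unit flow along a trail from `a` to `b`. -/
theorem SimpleGraph.Walk.IsTrail.exists_unit_flow {V : Type*} [Fintype V] [DecidableEq V]
    {G : SimpleGraph V} {a b : V} (p : G.Walk a b) (hp : p.IsTrail) :
    ∃ F : V → V → ℤ, (∀ u v, F u v = -F v u) ∧
      (∀ u v, |F u v| = if s(u, v) ∈ p.edges then 1 else 0) ∧
      ∀ u, ∑ v, F u v = (if u = a then 1 else 0) - (if u = b then 1 else 0) := by
  induction p with
  | nil => exact ⟨fun _ _ => 0, by simp, by simp, by simp⟩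
  | @cons a c b h p ih =>
    rw [SimpleGraph.Walk.isTrail_cons] at hp
    obtain ⟨F, hanti, habs, hsum⟩ := ih hp.1
    have hac : a ≠ c := h.ne
    refine ⟨fun u v => F u v + ((if u = a then if v = c then 1 else 0 else 0)
      - (if u = c then if v = a then 1 else 0 else 0)), ?_, ?_, ?_⟩
    · intro u v
      have := hanti u v
      grind
    · intro u v
      by_cases huv : s(u, v) = s(a, c)
      · have h0 : F u v = 0 := by
          have := habs u v
          rw [huv, if_neg hp.2] at this
          exact abs_eq_zero.1 this
        simp only [SimpleGraph.Walk.edges_cons, huv, List.mem_cons, true_or, if_true, h0, zero_add]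
        rcases Sym2.eq_iff.1 huv with ⟨rfl, rfl⟩ | ⟨rfl, rfl⟩
        · simp [hac]
        · simp [hac.symm]
      · have := habs u v
        simp only [SimpleGraph.Walk.edges_cons, List.mem_cons, huv, false_or]
        rw [← this]
        rw [Sym2.eq_iff] at huv
        grind
    · intro u
      rw [Finset.sum_add_distrib, hsum, Finset.sum_sub_distrib]
      have h1 : ∑ v, (if u = a then if v = c then (1 : ℤ) else 0 else 0) =
          if u = a then 1 else 0 := by
        split_ifs <;> simp
      have h2 : ∑ v, (if u = c then if v = a then (1 : ℤ) else 0 else 0) =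
          if u = c then 1 else 0 := by
        split_ifs <;> simp
      rw [h1, h2]
      ring

open Classical in
/-- A finite acyclic graph all of whose degrees are even has no edges. -/
theorem SimpleGraph.IsAcyclic.eq_bot_of_even_degree {V : Type*} [Fintype V]
    {G : SimpleGraph V} (hG : G.IsAcyclic) (h : ∀ v, Even (G.degree v)) : G = ⊥ := by
  by_contra hne
  obtain ⟨x, y, hxy⟩ := SimpleGraph.ne_bot_iff_exists_adj.1 hne
  have : Nonempty V := ⟨x⟩
  have ⟨u, v, p, hp, hmax⟩ := SimpleGraph.Walk.exists_isPath_forall_isPath_length_le_length G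
  have hnil : ¬p.Nil := by
    intro hn
    have h1 := hmax x y hxy.toWalk (by simp [SimpleGraph.Adj.toWalk, hxy.ne])
    have h2 := SimpleGraph.Walk.length_eq_zero_iff.2 hn
    simp [SimpleGraph.Adj.toWalk] at h1
    omega
  have hdeg : G.degree u = 1 := by
    rw [SimpleGraph.degree_eq_one_iff_existsUnique_adj]
    refine ⟨_, p.adj_snd hnil, fun w hadj ↦ ?_⟩
    apply hG.eq_snd_of_adj_start hp hadj
    have : ¬(p.cons hadj.symm).IsPath := by grind [SimpleGraph.Walk.length_cons]
    grind [hp.cons]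
  have := h u
  rw [hdeg] at this
  exact absurd this (by decide)

/-- An integer sum has the parity of the sum of absolute values. -/
theorem Finset.even_sum_iff_even_sum_abs {ι : Type*} (s : Finset ι) (f : ι → ℤ) :
    Even (∑ i ∈ s, f i) ↔ Even (∑ i ∈ s, |f i|) := by
  rw [← Int.even_sub, ← Finset.sum_sub_distrib]
  refine Finset.even_sum _ fun i _ => ?_
  rw [Int.even_sub, even_abs]

open Classical in
/-- A finite graph with even degrees has an Eulerian orientation. -/
theorem SimpleGraph.exists_unit_flow_of_even_degree {V : Type*} [Fintype V]
    (G : SimpleGraph V) (h : ∀ v, Even (G.degree v)) :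
    ∃ F : V → V → ℤ, (∀ u v, F u v = -F v u) ∧
      (∀ u v, |F u v| = if G.Adj u v then 1 else 0) ∧ ∀ u, ∑ v, F u v = 0 := by
  induction G using WellFoundedLT.induction with
  | ind G ih =>
    by_cases hac : G.IsAcyclic
    · rw [hac.eq_bot_of_even_degree h]
      exact ⟨fun _ _ => 0, by simp, by simp, by simp⟩
    · simp only [SimpleGraph.IsAcyclic, not_forall, not_not] at hac
      obtain ⟨a, p, hp⟩ := hac
      obtain ⟨F, hanti, habs, hsum⟩ := hp.isTrail.exists_unit_flow
      have hpG : ∀ u v, s(u, v) ∈ p.edges → G.Adj u v := fun u v hm => p.adj_of_mem_edges hm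
      obtain ⟨H, hle, hadj⟩ : ∃ H ≤ G, ∀ u v, H.Adj u v ↔ G.Adj u v ∧ s(u, v) ∉ p.edges :=
        ⟨G.deleteEdges {e | e ∈ p.edges}, SimpleGraph.deleteEdges_le _, by simp⟩
      have hlt : H < G := by
        refine lt_of_le_of_ne hle fun he => ?_
        have hs : s(a, p.snd) ∈ p.edges := p.mk_start_snd_mem_edges hp.not_nil
        have h1 : H.Adj a p.snd := by rw [he]; exact hpG _ _ hs
        exact ((hadj _ _).1 h1).2 hs
      have hdegsum : ∀ (K : SimpleGraph V) (v : V),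
          (K.degree v : ℤ) = ∑ u, if K.Adj v u then 1 else 0 := by
        intro K v
        rw [Finset.sum_boole, ← SimpleGraph.card_neighborFinset_eq_degree,
          SimpleGraph.neighborFinset_eq_filter]
      have hH : ∀ v, Even (H.degree v) := fun v => by
        have h1 : (G.degree v : ℤ) = H.degree v + ∑ u, |F v u| := by
          rw [hdegsum G, hdegsum H, ← Finset.sum_add_distrib]
          refine Finset.sum_congr rfl fun u _ => ?_
          rw [habs]
          have := hadj v u
          have := hpG v u
          grind
        have h2 : Even (∑ u, |F v u|) := by
          rw [← Finset.even_sum_iff_even_sum_abs, hsum]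
          simp
        have h3 : Even (G.degree v : ℤ) := by exact_mod_cast h v
        rw [h1, Int.even_add] at h3
        exact_mod_cast h3.2 h2
      obtain ⟨F', hanti', habs', hsum'⟩ := ih H hlt fun v => by convert hH v
      refine ⟨fun u v => F u v + F' u v, fun u v => ?_, fun u v => ?_, fun u => ?_⟩
      · linarith [hanti u v, hanti' u v]
      · have h1 := habs u v
        have h2 := habs' u v
        have := hadj u v
        by_cases hm : s(u, v) ∈ p.edges
        · have : F' u v = 0 := by
            rw [if_neg (by tauto)] at h2
            exact abs_eq_zero.1 h2
          simp [this, h1, hm, hpG u v hm]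
        · have : F u v = 0 := by
            rw [if_neg hm] at h1
            exact abs_eq_zero.1 h1
          simp [this, h2, hadj u v, hm]
      · rw [Finset.sum_add_distrib, hsum, hsum']
        simp

/-- The vertices of a centred regular simplex, scaled so that sums of two of them are unit
vectors. -/
theorem exists_simplex_vectors (d : ℕ) (hd : 3 ≤ d) :
    ∃ w : Fin d → EuclideanSpace ℝ (Fin (d - 1)), ∀ i j, i ≠ j →
      ‖w i + w j‖ = 1 ∧ ‖w i - w j‖ = Real.sqrt ((d : ℝ) / ((d : ℝ) - 2)) := by
  have hd' : (3 : ℝ) ≤ d := by exact_mod_cast hd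
  have hd2 : (0 : ℝ) < (d : ℝ) - 2 := by linarith
  let o : EuclideanSpace ℝ (Fin d) := WithLp.toLp 2 fun _ => 1
  have ho : o ≠ 0 := by
    intro h
    have := congrArg (fun x : EuclideanSpace ℝ (Fin d) => x ⟨0, by omega⟩) h
    simp [o] at this
  have hfin : Fact (Module.finrank ℝ (EuclideanSpace ℝ (Fin d)) = (d - 1) + 1) := ⟨by simp; omega⟩
  let B := OrthonormalBasis.fromOrthogonalSpanSingleton (𝕜 := ℝ) (d - 1) ho
  let s : ℝ := Real.sqrt ((d : ℝ) / (2 * ((d : ℝ) - 2)))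
  have hs : s ^ 2 = (d : ℝ) / (2 * ((d : ℝ) - 2)) := Real.sq_sqrt (by positivity)
  let x : Fin d → EuclideanSpace ℝ (Fin d) := fun i => s • (EuclideanSpace.single i (1 : ℝ) - (1 / (d : ℝ)) • o)
  have hoo : inner ℝ o o = (d : ℝ) := by
    rw [PiLp.inner_apply]
    simp [o]
  have heo : ∀ i, inner ℝ (EuclideanSpace.single i (1 : ℝ)) o = (1 : ℝ) := by
    intro i
    rw [EuclideanSpace.inner_single_left]
    simp [o]
  have hoe : ∀ i, inner ℝ o (EuclideanSpace.single i (1 : ℝ)) = (1 : ℝ) := by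
    intro i
    rw [real_inner_comm, heo]
  have hee : ∀ i j : Fin d, inner ℝ (EuclideanSpace.single i (1 : ℝ))
      (EuclideanSpace.single j (1 : ℝ)) = if i = j then (1 : ℝ) else 0 := by
    intro i j
    rw [EuclideanSpace.inner_single_left]
    simp
  have hmem : ∀ i, x i ∈ (ℝ ∙ o)ᗮ := by
    intro i
    rw [Submodule.mem_orthogonal_singleton_iff_inner_right]
    simp only [x, inner_smul_right, inner_sub_right, hoo, hoe]
    field_simp
    simp
  have hinner : ∀ i j, inner ℝ (x i) (x j) =
      s ^ 2 * ((if i = j then 1 else 0) - 1 / (d : ℝ)) := by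
    intro i j
    simp only [x, real_inner_smul_left, real_inner_smul_right, inner_sub_left, inner_sub_right, hoo,
      heo, hoe, hee]
    field_simp
    ring
  refine ⟨fun i => B.repr ⟨x i, hmem i⟩, fun i j hij => ?_⟩
  have e1 : ‖B.repr ⟨x i, hmem i⟩ + B.repr ⟨x j, hmem j⟩‖ = ‖x i + x j‖ := by
    rw [← map_add, LinearIsometryEquiv.norm_map]; rfl
  have e2 : ‖B.repr ⟨x i, hmem i⟩ - B.repr ⟨x j, hmem j⟩‖ = ‖x i - x j‖ := by
    rw [← map_sub, LinearIsometryEquiv.norm_map]; rfl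
  rw [e1, e2]
  constructor
  · rw [← sq_eq_sq₀ (norm_nonneg _) zero_le_one, norm_add_sq_real, ← real_inner_self_eq_norm_sq,
      ← real_inner_self_eq_norm_sq, hinner, hinner, hinner, if_neg hij, hs]
    simp
    field_simp
    ring
  · rw [← sq_eq_sq₀ (norm_nonneg _) (Real.sqrt_nonneg _), Real.sq_sqrt (by positivity),
      norm_sub_sq_real, ← real_inner_self_eq_norm_sq,
      ← real_inner_self_eq_norm_sq, hinner, hinner, hinner, if_neg hij, hs]
    simp
    field_simp
    ring

/-- If `G` has a `d`-cycle double cover (`d ≥ 3`), then `φ_{d-1}(G) ≤ 1 + √(d/(d-2))`. -/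
theorem stmt11 {V : Type*} [Fintype V] [DecidableEq V] (G : SimpleGraph V) (d : ℕ)
    (hd : 3 ≤ d) (h : ∃ c : Fin d → V → V → Bool, IsCDC G c) :
    flowNumber G (d - 1) ≤ 1 + Real.sqrt ((d : ℝ) / ((d : ℝ) - 2)) := by
  classical
  obtain ⟨c, hsymm, hsub, heven, htwo⟩ := h
  have hd' : (3 : ℝ) ≤ d := by exact_mod_cast hd
  have hone : (1 : ℝ) ≤ Real.sqrt ((d : ℝ) / ((d : ℝ) - 2)) := by
    rw [Real.one_le_sqrt, one_le_div (by linarith)]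
    linarith
  have hflow : ∀ i, ∃ F : V → V → ℤ, (∀ u v, F u v = -F v u) ∧
      (∀ u v, |F u v| = if c i u v = true then 1 else 0) ∧ ∀ u, ∑ v, F u v = 0 := by
    intro i
    let H : SimpleGraph V :=
      { Adj := fun u v => c i u v = true
        symm := ⟨fun u v huv => by rwa [hsymm]⟩
        loopless := ⟨fun u hu => G.loopless.irrefl u (hsub i u u hu)⟩ }
    obtain ⟨F, hF⟩ := H.exists_unit_flow_of_even_degree fun v => by
      rw [← SimpleGraph.card_neighborFinset_eq_degree, SimpleGraph.neighborFinset_eq_filter]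
      convert heven i v
    exact ⟨F, hF.1, fun u v => by convert hF.2.1 u v, hF.2.2⟩
  choose F hanti habs hsum using hflow
  obtain ⟨w, hw⟩ := exists_simplex_vectors d hd
  refine csInf_le ⟨2, fun r hr => hr.1⟩ ⟨by linarith, fun u v => ∑ i, (F i u v : ℝ) • w i,
    ⟨fun u v => ?_, fun u v huv => ?_, fun v => ?_⟩, fun u v huv => ?_⟩
  · rw [← Finset.sum_neg_distrib]
    refine Finset.sum_congr rfl fun i _ => ?_
    rw [hanti i u v]
    simp
  · refine Finset.sum_eq_zero fun i _ => ?_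
    have h0 := habs i u v
    rw [if_neg fun hc => huv (hsub i u v hc)] at h0
    rw [abs_eq_zero.1 h0]
    simp
  · rw [Finset.sum_comm]
    refine Finset.sum_eq_zero fun i _ => ?_
    rw [← Finset.sum_smul, ← Int.cast_sum, hsum]
    simp
  · obtain ⟨i, j, hij, hpair⟩ := Finset.card_eq_two.1 (htwo u v huv)
    have hmem : ∀ k, c k u v = true ↔ k = i ∨ k = j := fun k => by
      simpa using Finset.ext_iff.1 hpair k
    have hval : ∑ k, (F k u v : ℝ) • w k = (F i u v : ℝ) • w i + (F j u v : ℝ) • w j := by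
      rw [← Finset.sum_pair (f := fun k => (F k u v : ℝ) • w k) hij]
      refine (Finset.sum_subset (Finset.subset_univ _) fun k _ hk => ?_).symm
      have h0 := habs k u v
      rw [if_neg (by simpa [hmem] using hk)] at h0
      rw [abs_eq_zero.1 h0]
      simp
    have hFi : |F i u v| = 1 := by rw [habs, if_pos ((hmem i).2 (Or.inl rfl))]
    have hFj : |F j u v| = 1 := by rw [habs, if_pos ((hmem j).2 (Or.inr rfl))]
    obtain ⟨hadd, hdiff⟩ := hw i j hij
    simp only [hval, add_sub_cancel_left]
    rcases (abs_eq zero_le_one).1 hFi with h1 | h1 <;>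
      rcases (abs_eq zero_le_one).1 hFj with h2 | h2 <;> rw [h1, h2]
    · have e : ((1 : ℤ) : ℝ) • w i + ((1 : ℤ) : ℝ) • w j = w i + w j := by simp
      rw [e, hadd]
      exact ⟨le_rfl, hone⟩
    · have e : ((1 : ℤ) : ℝ) • w i + ((-1 : ℤ) : ℝ) • w j = w i - w j := by
        simp [sub_eq_add_neg]
      rw [e, hdiff]
      exact ⟨hone, le_rfl⟩
    · have e : ((-1 : ℤ) : ℝ) • w i + ((1 : ℤ) : ℝ) • w j = -(w i - w j) := by
        simp [sub_eq_add_neg, add_comm]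
      rw [e, norm_neg, hdiff]
      exact ⟨hone, le_rfl⟩
    · have e : ((-1 : ℤ) : ℝ) • w i + ((-1 : ℤ) : ℝ) • w j = -(w i + w j) := by
        simp [add_comm]
      rw [e, norm_neg, hadd]
      exact ⟨le_rfl, hone⟩
end

section
/- A graph G admits a nowhere-zero 3-flow if and only if G admits an H_3-flow, where H_3 = {(1,−1,0),(−1,1,0),(1,0,−1),(−1,0,1),(0,1,−1),(0,−1,1)}. -/
open scoped BigOperators

/-- The boundary vectors `δ_a - δ_b` of the (possibly degenerate) arcs on a vertex set. -/
def IsArc {V : Type*} [DecidableEq V] (x : V → ℤ) : Prop :=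
  ∃ a b, x = Pi.single a 1 - Pi.single b 1

lemma IsArc.abs_le_one {V : Type*} [DecidableEq V] {x : V → ℤ} (hx : IsArc x) (v : V) :
    |x v| ≤ 1 := by
  obtain ⟨a, b, rfl⟩ := hx
  simp only [Pi.sub_apply, Pi.single_apply]
  split_ifs <;> simp

/-- Two arcs with a common end can be concatenated after possibly reversing one of them. -/
lemma IsArc.exists_add {V : Type*} [DecidableEq V] {x y : V → ℤ} (hx : IsArc x) (hy : IsArc y)
    {v : V} (hxv : x v ≠ 0) (hyv : y v ≠ 0) :
    ∃ σ : ℤ, (σ = 1 ∨ σ = -1) ∧ IsArc (x + σ • y) := by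
  obtain ⟨a, b, rfl⟩ := hx
  obtain ⟨c, d, rfl⟩ := hy
  have h₁ : v = a ∨ v = b := by
    by_contra! h
    simp [h.1, h.2] at hxv
  have h₂ : v = c ∨ v = d := by
    by_contra! h
    simp [h.1, h.2] at hyv
  rcases h₁ with rfl | rfl <;> rcases h₂ with rfl | rfl
  · exact ⟨-1, Or.inr rfl, d, b, by simp⟩
  · exact ⟨1, Or.inl rfl, c, b, by simp⟩
  · exact ⟨1, Or.inl rfl, a, d, by simp⟩
  · exact ⟨-1, Or.inr rfl, a, c, by simp⟩

/-- Every finite family of arcs can be reoriented so that each vertex has imbalance at most one. -/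
lemma exists_signs_abs_sum_le_one {V ι : Type*} [DecidableEq V] [DecidableEq ι] (s : Finset ι)
    (x : ι → V → ℤ) (hx : ∀ i, IsArc (x i)) :
    ∃ ε : ι → ℤ, (∀ i, ε i = 1 ∨ ε i = -1) ∧ ∀ v, |∑ i ∈ s, ε i * x i v| ≤ 1 := by
  induction hn : s.card generalizing s x with
  | zero =>
    obtain rfl := Finset.card_eq_zero.mp hn
    exact ⟨fun _ => 1, by simp, by simp⟩
  | succ n ih =>
    by_cases h : ∃ i ∈ s, ∃ j ∈ s, i ≠ j ∧ ∃ v, x i v ≠ 0 ∧ x j v ≠ 0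
    · obtain ⟨i, hi, j, hj, hij, v, hiv, hjv⟩ := h
      obtain ⟨σ, hσ, harc⟩ := (hx i).exists_add (hx j) hiv hjv
      obtain ⟨ε, hε, hsum⟩ := ih (s.erase j) (Function.update x i (x i + σ • x j))
        (fun k => by
          rcases eq_or_ne k i with rfl | hk
          · simpa using harc
          · simpa [hk] using hx k)
        (by rw [Finset.card_erase_of_mem hj, hn, Nat.add_sub_cancel])
      refine ⟨Function.update ε j (σ * ε i), fun k => ?_, fun w => ?_⟩
      · rcases eq_or_ne k j with rfl | hk
        · rcases hσ with rfl | rfl <;> rcases hε i with h | h <;> simp [h]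
        · simpa [hk] using hε k
      · convert hsum w using 2
        have hi' : i ∈ s.erase j := Finset.mem_erase.mpr ⟨hij, hi⟩
        rw [← Finset.add_sum_erase s _ hj, ← Finset.add_sum_erase _ _ hi',
          ← Finset.add_sum_erase _ _ hi']
        have hrest : ∑ k ∈ (s.erase j).erase i, Function.update ε j (σ * ε i) k * x k w =
            ∑ k ∈ (s.erase j).erase i,
              ε k * Function.update x i (x i + σ • x j) k w := by
          refine Finset.sum_congr rfl fun k hk => ?_
          simp only [Finset.mem_erase] at hk
          simp [hk.1, hk.2.1]
        rw [hrest]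
        simp [hij]
        ring
    · push Not at h
      refine ⟨fun _ => 1, by simp, fun v => ?_⟩
      by_cases hv : ∃ i ∈ s, x i v ≠ 0
      · obtain ⟨i, hi, hiv⟩ := hv
        rw [Finset.sum_eq_single_of_mem i hi fun j hj hji => by
          rw [h i hi j hj hji.symm v hiv, mul_zero], one_mul]
        exact (hx i).abs_le_one v
      · push Not at hv
        rw [Finset.sum_eq_zero fun i hi => by rw [hv i hi, mul_zero]]
        simp

/-- The odd edges of an integer flow carry a flow with values `±1`. -/
lemma exists_unit_flow_on_odd {V : Type*} [Fintype V] (g : V → V → ℤ)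
    (hg : ∀ u v, g u v = -g v u) (hsum : ∀ v, ∑ u, g v u = 0) :
    ∃ h : V → V → ℤ, (∀ u v, h u v = -h v u) ∧ (∀ v, ∑ u, h v u = 0) ∧
      (∀ u v, Odd (g u v) → h u v = 1 ∨ h u v = -1) ∧ ∀ u v, Even (g u v) → h u v = 0 := by
  classical
  let _ : LinearOrder V := LinearOrder.lift' (Fintype.equivFin V) (Fintype.equivFin V).injective
  obtain ⟨ε, hε, hle⟩ := exists_signs_abs_sum_le_one
    (Finset.univ.filter fun p : V × V => p.1 < p.2 ∧ Odd (g p.1 p.2))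
    (fun p => Pi.single p.1 1 - Pi.single p.2 1) (fun p => ⟨p.1, p.2, rfl⟩)
  let k : V → V → ℤ := fun a b => if a < b ∧ Odd (g a b) then ε (a, b) else 0
  have hodd (u v) : Odd (g u v) ↔ Odd (g v u) := by rw [hg u v, odd_neg]
  have h₁ (u v) (huv : Odd (g u v)) : k u v - k v u = 1 ∨ k u v - k v u = -1 := by
    have hvu := (hodd u v).mp huv
    rcases lt_trichotomy u v with hlt | rfl | hlt
    · simpa [k, huv, hlt, hlt.not_gt] using hε (u, v)
    · have h0 : g u u = 0 := by linarith [hg u u]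
      simp [h0] at huv
    · have := hε (v, u)
      simp only [k, hvu, hlt, hlt.not_gt]
      simp
      omega
  have h₀ (u v) (huv : Even (g u v)) : k u v - k v u = 0 := by
    have hn : ¬ Odd (g u v) := Int.not_odd_iff_even.mpr huv
    have hn' : ¬ Odd (g v u) := fun h => hn ((hodd u v).mpr h)
    simp [k, hn, hn']
  refine ⟨fun u v => k u v - k v u, fun u v => by ring, fun v => ?_, h₁, h₀⟩
  have hb : |∑ u, (k v u - k u v)| ≤ 1 := by
    convert hle v using 2
    rw [Finset.sum_filter, Fintype.sum_prod_type, Finset.sum_sub_distrib]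
    have hterm (a b : V) : (if a < b ∧ Odd (g a b) then
        ε (a, b) * ((Pi.single a 1 - Pi.single b 1 : V → ℤ) v) else 0) =
        (if v = a then k a b else 0) - (if v = b then k a b else 0) := by
      simp only [k, Pi.sub_apply, Pi.single_apply]
      split_ifs <;> simp
    simp only [hterm, Finset.sum_sub_distrib]
    congr 1
    · rw [Finset.sum_comm]
      simp
    · simp
  have heven : Even (∑ u, (k v u - k u v)) := by
    have : Even (∑ u, ((k v u - k u v) - g v u)) := by
      refine Finset.even_sum _ fun u _ => ?_
      rcases Int.even_or_odd (g v u) with he | ho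
      · rw [h₀ v u he, zero_sub]
        exact he.neg
      · refine Odd.sub_odd ?_ ho
        rcases h₁ v u ho with h | h <;> rw [h] <;> decide
    rwa [Finset.sum_sub_distrib, hsum v, sub_zero] at this
  obtain ⟨m, hm⟩ := heven
  rw [abs_le] at hb
  show ∑ u, (k v u - k u v) = 0
  omega

lemma mem_Hd_three {x : EuclideanSpace ℝ (Fin 3)} :
    x ∈ Hd 3 ↔ (x 0 = 1 ∧ x 1 = -1 ∧ x 2 = 0) ∨ (x 0 = -1 ∧ x 1 = 1 ∧ x 2 = 0) ∨
      (x 0 = 1 ∧ x 1 = 0 ∧ x 2 = -1) ∨ (x 0 = -1 ∧ x 1 = 0 ∧ x 2 = 1) ∨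
      (x 0 = 0 ∧ x 1 = 1 ∧ x 2 = -1) ∨ (x 0 = 0 ∧ x 1 = -1 ∧ x 2 = 1) := by
  simp only [Hd, Set.mem_ofPred_eq, Fin.exists_fin_succ, Fin.forall_fin_succ]
  simp
  tauto

/-- A graph admits a nowhere-zero 3-flow (an integer flow with edge values in
`{±1, ±2}`) iff it admits an `H_3`-flow. -/
theorem stmt16 {V : Type*} [Fintype V] (G : SimpleGraph V) :
    (∃ f : V → V → ℤ, (∀ u v, f u v = - f v u) ∧ (∀ u v, ¬ G.Adj u v → f u v = 0) ∧
      (∀ v, ∑ u, f v u = 0) ∧ (∀ u v, G.Adj u v → f u v ≠ 0 ∧ |f u v| ≤ 2)) ↔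
    HasFlowIn G (Hd 3) := by
  constructor
  · rintro ⟨g, hanti, hsupp, hsum, hval⟩
    obtain ⟨h, hanti', hsum', hodd, heven⟩ := exists_unit_flow_on_odd g hanti hsum
    refine ⟨fun u v => !₂[((g u v : ℝ) - h u v) / 2, (h u v : ℝ), (-(g u v : ℝ) - h u v) / 2],
      ⟨fun u v => ?_, fun u v huv => ?_, fun v => ?_⟩, fun u v huv => ?_⟩
    · ext i
      fin_cases i <;> simp [hanti u v, hanti' u v] <;> ring
    · have hg0 := hsupp u v huv
      have hh0 := heven u v (by simp [hg0])
      ext i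
      fin_cases i <;> simp [hg0, hh0]
    · have hg0 : ∑ u, (g v u : ℝ) = 0 := by exact_mod_cast hsum v
      have hh0 : ∑ u, (h v u : ℝ) = 0 := by exact_mod_cast hsum' v
      ext i
      fin_cases i <;>
        simp [← Finset.sum_div, Finset.sum_sub_distrib, Finset.sum_neg_distrib, hg0, hh0]
    · obtain ⟨hne, hle⟩ := hval u v huv
      rw [abs_le] at hle
      have hcases : g u v = 1 ∨ g u v = -1 ∨ g u v = 2 ∨ g u v = -2 := by omega
      rw [mem_Hd_three]
      rcases hcases with hg | hg | hg | hg
      · rcases hodd u v (by rw [hg]; decide) with hh | hh <;> simp [hg, hh] <;> norm_num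
      · rcases hodd u v (by rw [hg]; decide) with hh | hh <;> simp [hg, hh] <;> norm_num
      · simp [hg, heven u v (by rw [hg]; decide)]
      · simp [hg, heven u v (by rw [hg]; decide)]
  · rintro ⟨F, ⟨hanti, hsupp, hsum⟩, hval⟩
    have key (u v) : ∃ n : ℤ, (n : ℝ) = F u v 0 - F u v 2 ∧ (G.Adj u v → n ≠ 0 ∧ |n| ≤ 2) := by
      by_cases huv : G.Adj u v
      · rcases mem_Hd_three.mp (hval u v huv) with
          ⟨h0, -, h2⟩ | ⟨h0, -, h2⟩ | ⟨h0, -, h2⟩ | ⟨h0, -, h2⟩ | ⟨h0, -, h2⟩ | ⟨h0, -, h2⟩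
        · exact ⟨1, by norm_num [h0, h2], by simp⟩
        · exact ⟨-1, by norm_num [h0, h2], by simp⟩
        · exact ⟨2, by norm_num [h0, h2], by simp⟩
        · exact ⟨-2, by norm_num [h0, h2], by simp⟩
        · exact ⟨1, by norm_num [h0, h2], by simp⟩
        · exact ⟨-1, by norm_num [h0, h2], by simp⟩
      · exact ⟨0, by simp [hsupp u v huv], fun h => absurd h huv⟩
    choose g hg hgval using key
    refine ⟨g, fun u v => ?_, fun u v huv => ?_, fun v => ?_, hgval⟩
    · have : (g u v : ℝ) = -g v u := by
        rw [hg, hg, hanti u v]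
        simp
        ring
      exact_mod_cast this
    · have : (g u v : ℝ) = 0 := by simp [hg, hsupp u v huv]
      exact_mod_cast this
    · have hcoord (i : Fin 3) : ∑ u, F v u i = 0 := by
        simpa using congrArg (fun x => x i) (hsum v)
      have : ∑ u, (g v u : ℝ) = 0 := by
        simp only [hg, Finset.sum_sub_distrib, hcoord, sub_zero]
      exact_mod_cast this
end

section
/- For every graph G and every positive integer d, the d-dimensional flow number φ_d(G) of a bridgeless graph G is attained: there exists an (φ_d(G), d)-NZF on G. Moreover φ_d(G) ≤ 6. -/
open scoped BigOperators

open SimpleGraph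

/-- An integer flow on a graph: antisymmetric on ordered pairs of vertices, supported on the
edges, and conserved at every vertex. -/
structure IsIntFlow {V : Type*} [Fintype V] (G : SimpleGraph V) (f : V → V → ℤ) : Prop where
  antisymm : ∀ u v, f u v = -f v u
  support : ∀ u v, ¬G.Adj u v → f u v = 0
  conserved : ∀ v, ∑ u, f v u = 0

namespace IsIntFlow

variable {V : Type*} [Fintype V] {G : SimpleGraph V} {f g : V → V → ℤ}

lemma zero (G : SimpleGraph V) : IsIntFlow G (fun _ _ => 0) := ⟨by simp, by simp, by simp⟩

lemma add (hf : IsIntFlow G f) (hg : IsIntFlow G g) :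
    IsIntFlow G (fun u v => f u v + g u v) where
  antisymm u v := by rw [hf.antisymm u v, hg.antisymm u v]; ring
  support u v h := by rw [hf.support u v h, hg.support u v h, add_zero]
  conserved v := by rw [Finset.sum_add_distrib, hf.conserved, hg.conserved, add_zero]

lemma const_mul (c : ℤ) (hf : IsIntFlow G f) : IsIntFlow G (fun u v => c * f u v) where
  antisymm u v := by rw [hf.antisymm u v]; ring
  support u v h := by rw [hf.support u v h, mul_zero]
  conserved v := by rw [← Finset.mul_sum, hf.conserved, mul_zero]

/-- The net flow across a cut vanishes. -/
lemma sum_cut [DecidableEq V] (hf : IsIntFlow G f) (X : Finset V) :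
    ∑ p ∈ X ×ˢ Xᶜ, f p.1 p.2 = 0 := by
  rw [Finset.sum_product]
  have h1 : ∑ u ∈ X, ∑ v ∈ X, f u v = 0 := by
    have : ∑ u ∈ X, ∑ v ∈ X, f u v = -∑ u ∈ X, ∑ v ∈ X, f u v := by
      conv_lhs => rw [Finset.sum_comm]
      simp only [← Finset.sum_neg_distrib]
      exact Finset.sum_congr rfl fun u _ => Finset.sum_congr rfl fun v _ => hf.antisymm v u
    linarith
  have h2 : ∑ u ∈ X, (∑ v ∈ X, f u v + ∑ v ∈ Xᶜ, f u v) = 0 :=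
    Finset.sum_eq_zero fun u _ => by rw [Finset.sum_add_sum_compl, hf.conserved]
  rw [Finset.sum_add_distrib, h1, zero_add] at h2
  exact h2

end IsIntFlow

section WalkFlow

variable {V : Type*} [DecidableEq V] {G : SimpleGraph V}

/-- One unit of flow sent from `a` to `b`. -/
def dartFlow (a b x y : V) : ℤ :=
  (if x = a ∧ y = b then 1 else 0) - (if x = b ∧ y = a then 1 else 0)

/-- One unit of flow sent along a walk. -/
def walkFlow : {u v : V} → G.Walk u v → V → V → ℤ
  | _, _, .nil => fun _ _ => 0
  | _, _, .cons (u := a) (v := b) _ p => fun x y => dartFlow a b x y + walkFlow p x y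

lemma dartFlow_antisymm (a b x y : V) : dartFlow a b x y = -dartFlow a b y x := by
  simp only [dartFlow, and_comm]; ring

lemma dartFlow_self {a b : V} (h : a ≠ b) : dartFlow a b a b = 1 := by
  simp [dartFlow, h]

lemma dartFlow_eq_zero {a b x y : V} (h : s(x, y) ≠ s(a, b)) : dartFlow a b x y = 0 := by
  simp only [ne_eq, Sym2.eq_iff, not_or] at h
  simp [dartFlow, h.1, h.2]

lemma sum_dartFlow [Fintype V] (a b x : V) :
    ∑ y, dartFlow a b x y = (if x = a then 1 else 0) - (if x = b then 1 else 0) := by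
  simp [dartFlow, Finset.sum_sub_distrib, ite_and]

lemma walkFlow_antisymm {u v : V} (p : G.Walk u v) (x y : V) :
    walkFlow p x y = -walkFlow p y x := by
  induction p with
  | nil => simp [walkFlow]
  | cons h p ih => simp only [walkFlow, ih, dartFlow_antisymm _ _ x y]; ring

lemma sum_walkFlow [Fintype V] {u v : V} (p : G.Walk u v) (x : V) :
    ∑ y, walkFlow p x y = (if x = u then 1 else 0) - (if x = v then 1 else 0) := by
  induction p with
  | nil => simp [walkFlow]
  | cons h p ih => simp only [walkFlow, Finset.sum_add_distrib, ih, sum_dartFlow]; ring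

lemma walkFlow_eq_zero {u v : V} (p : G.Walk u v) {x y : V} (h : s(x, y) ∉ p.edges) :
    walkFlow p x y = 0 := by
  induction p with
  | nil => simp [walkFlow]
  | cons _ p ih =>
    simp only [Walk.edges_cons, List.mem_cons, not_or] at h
    simp only [walkFlow, ih h.2, dartFlow_eq_zero h.1, add_zero]

lemma walkFlow_eq_zero_of_not_adj {u v : V} (p : G.Walk u v) {x y : V} (h : ¬G.Adj x y) :
    walkFlow p x y = 0 :=
  walkFlow_eq_zero p fun h' => h (p.adj_of_mem_edges h')

/-- Along a trail, every edge carries exactly one unit, in the direction in which it is used. -/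
lemma walkFlow_of_isTrail {u v : V} {p : G.Walk u v} (hp : p.IsTrail) {x y : V}
    (h : s(x, y) ∈ p.edges) :
    (walkFlow p x y = 1 ∧ ∃ d ∈ p.darts, d.fst = x ∧ d.snd = y) ∨
      (walkFlow p x y = -1 ∧ ∃ d ∈ p.darts, d.fst = y ∧ d.snd = x) := by
  induction p with
  | nil => simp at h
  | @cons a b _ hab p ih =>
    rw [Walk.isTrail_cons] at hp
    by_cases hxy : s(x, y) = s(a, b)
    · have h0 : walkFlow p x y = 0 := walkFlow_eq_zero p (hxy ▸ hp.2)
      simp only [walkFlow, h0, add_zero]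
      rcases Sym2.eq_iff.1 hxy with ⟨rfl, rfl⟩ | ⟨rfl, rfl⟩
      · exact Or.inl ⟨dartFlow_self hab.ne, ⟨(x, y), hab⟩, by simp, rfl, rfl⟩
      · exact Or.inr ⟨by rw [dartFlow_antisymm, dartFlow_self hab.ne], ⟨(y, x), hab⟩, by simp,
          rfl, rfl⟩
    · have h' : s(x, y) ∈ p.edges := by simpa [hxy] using h
      simp only [walkFlow, dartFlow_eq_zero hxy, zero_add, Walk.darts_cons, List.mem_cons]
      rcases ih hp.1 h' with ⟨h1, d, hd, h2⟩ | ⟨h1, d, hd, h2⟩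
      · exact Or.inl ⟨h1, d, Or.inr hd, h2⟩
      · exact Or.inr ⟨h1, d, Or.inr hd, h2⟩

lemma isIntFlow_walkFlow [Fintype V] {K : SimpleGraph V} (hK : K ≤ G) {u : V} (p : K.Walk u u) :
    IsIntFlow G (walkFlow p) where
  antisymm := walkFlow_antisymm p
  support _ _ h := walkFlow_eq_zero_of_not_adj p fun h' => h (hK h')
  conserved v := by rw [sum_walkFlow, sub_self]

end WalkFlow

/-- An arc carrying positive flow lies on a directed cycle of arcs carrying positive flow. -/
lemma IsIntFlow.exists_cycle {V : Type*} [Fintype V] {G : SimpleGraph V}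
    {f : V → V → ℤ} (hf : IsIntFlow G f) {a b : V} (hab : 0 < f a b) :
    ∃ c : V → V → ℤ, IsIntFlow G c ∧ c a b = 1 ∧
      ∀ x y, c x y = 0 ∨ (c x y = 1 ∧ 0 < f x y) ∨ (c x y = -1 ∧ f x y < 0) := by
  classical
  have hadj : ∀ {x y}, f x y ≠ 0 → G.Adj x y := fun h => by
    by_contra h'; exact h (hf.support _ _ h')
  let P : G.Dart → Prop := fun d => 0 < f d.fst d.snd ∧ ¬(d.fst = a ∧ d.snd = b)
  let R : Finset V := Finset.univ.filter fun v => ∃ p : G.Walk b v, ∀ d ∈ p.darts, P d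
  have hbR : b ∈ R := Finset.mem_filter.2 ⟨Finset.mem_univ _, Walk.nil, by simp⟩
  have haR : a ∈ R := by
    by_contra haR
    have hle : ∀ p ∈ R ×ˢ Rᶜ, f p.1 p.2 ≤ 0 := by
      rintro ⟨x, y⟩ hxy
      obtain ⟨hx, hy⟩ := Finset.mem_product.1 hxy
      rw [Finset.mem_compl] at hy
      by_contra! hpos
      obtain ⟨-, p, hp⟩ := Finset.mem_filter.1 hx
      refine hy (Finset.mem_filter.2 ⟨Finset.mem_univ _, p.concat (hadj hpos.ne'), ?_⟩)
      intro d hd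
      rw [Walk.darts_concat, List.concat_eq_append, List.mem_append, List.mem_singleton] at hd
      rcases hd with hd | rfl
      · exact hp d hd
      · refine ⟨hpos, fun h => haR ?_⟩
        have : x = a := h.1
        exact this ▸ hx
    have : f b a = 0 := (Finset.sum_eq_zero_iff_of_nonpos hle).1 (hf.sum_cut R) (b, a)
      (Finset.mem_product.2 ⟨hbR, Finset.mem_compl.2 haR⟩)
    have h' := hf.antisymm a b
    omega
  obtain ⟨-, p, hp⟩ := Finset.mem_filter.1 haR
  have hq : ∀ d ∈ p.bypass.darts, P d := fun d hd => hp d (p.darts_bypass_subset_darts hd)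
  have hba : s(a, b) ∉ p.bypass.edges := by
    intro h
    obtain ⟨d, hd, he⟩ := List.mem_map.1 h
    obtain ⟨h1, h2⟩ := hq d hd
    rcases Sym2.eq_iff.1 he with h3 | ⟨h3, h4⟩
    · exact h2 h3
    · rw [h3, h4, hf.antisymm] at h1
      omega
  have hG := hadj hab.ne'
  have htrail : (Walk.cons hG p.bypass).IsTrail :=
    Walk.isTrail_cons _ _ |>.2 ⟨p.bypass_isPath.isTrail, hba⟩
  have hpos : ∀ d ∈ (Walk.cons hG p.bypass).darts, 0 < f d.fst d.snd := by
    intro d hd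
    rcases List.mem_cons.1 hd with rfl | hd
    · exact hab
    · exact (hq d hd).1
  refine ⟨walkFlow (Walk.cons hG p.bypass), isIntFlow_walkFlow le_rfl _, ?_, fun x y => ?_⟩
  · simp only [walkFlow, walkFlow_eq_zero _ hba, dartFlow_self hG.ne, add_zero]
  · by_cases h : s(x, y) ∈ (Walk.cons hG p.bypass).edges
    · rcases walkFlow_of_isTrail htrail h with ⟨h1, d, hd, rfl, rfl⟩ | ⟨h1, d, hd, rfl, rfl⟩
      · exact Or.inr (Or.inl ⟨h1, hpos d hd⟩)
      · refine Or.inr (Or.inr ⟨h1, ?_⟩)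
        have := hpos d hd
        rw [hf.antisymm] at this
        omega
    · exact Or.inl (walkFlow_eq_zero _ h)

/-- **Tutte**: every integer flow is congruent modulo `k` to one with values in `(-k, k)`. -/
lemma IsIntFlow.exists_abs_lt {V : Type*} [Fintype V] {G : SimpleGraph V} {k : ℤ} (hk : 0 < k)
    {f : V → V → ℤ} (hf : IsIntFlow G f) :
    ∃ g, IsIntFlow G g ∧ (∀ u v, k ∣ g u v - f u v) ∧ ∀ u v, |g u v| < k := by
  induction hn : ∑ u, ∑ v, (|f u v| - (k - 1)).toNat using Nat.strong_induction_on
    generalizing f with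
  | _ n ih =>
  by_cases hsmall : ∀ u v, |f u v| < k
  · exact ⟨f, hf, by simp, hsmall⟩
  push Not at hsmall
  obtain ⟨a, b, hab⟩ : ∃ a b, k ≤ f a b := by
    obtain ⟨u, v, h⟩ := hsmall
    rcases le_abs.1 h with h | h
    · exact ⟨u, v, h⟩
    · exact ⟨v, u, by rw [hf.antisymm]; exact h⟩
  obtain ⟨c, hc, hcab, hcf⟩ := hf.exists_cycle (hk.trans_le hab)
  have hle : ∀ u v, (|f u v + -k * c u v| - (k - 1)).toNat ≤ (|f u v| - (k - 1)).toNat := by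
    intro u v
    rcases hcf u v with h | ⟨h, h'⟩ | ⟨h, h'⟩ <;> rw [h] <;> grind
  have hlt : (|f a b + -k * c a b| - (k - 1)).toNat < (|f a b| - (k - 1)).toNat := by
    rw [hcab]; grind
  have hsum : ∑ u, ∑ v, (|f u v + -k * c u v| - (k - 1)).toNat < n := by
    rw [← hn]
    refine Finset.sum_lt_sum (fun u _ => Finset.sum_le_sum fun v _ => hle u v)
      ⟨a, Finset.mem_univ _, Finset.sum_lt_sum (fun v _ => hle a v) ⟨b, Finset.mem_univ _, hlt⟩⟩
  obtain ⟨g, hg, hgf, hgk⟩ := ih _ hsum (hf.add (hc.const_mul (-k))) rfl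
  refine ⟨g, hg, fun u v => ?_, hgk⟩
  have := (hgf u v).add (Dvd.intro (-c u v) rfl : k ∣ k * -c u v)
  rwa [show g u v - (f u v + -k * c u v) + k * -c u v = g u v - f u v by ring] at this

section Cuts

variable {V : Type*}

/-- At least two edges of `G` join `X` to `Y`, for disjoint vertex sets `X` and `Y`. -/
def TwoEdgesBetween (G : SimpleGraph V) (X Y : Set V) : Prop :=
  ∃ a ∈ X, ∃ b ∈ Y, ∃ a' ∈ X, ∃ b' ∈ Y, G.Adj a b ∧ G.Adj a' b' ∧ ¬(a' = a ∧ b' = b)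

lemma TwoEdgesBetween.symm {G : SimpleGraph V} {X Y : Set V} (h : TwoEdgesBetween G X Y) :
    TwoEdgesBetween G Y X := by
  obtain ⟨a, ha, b, hb, a', ha', b', hb', hab, hab', hne⟩ := h
  exact ⟨b, hb, a, ha, b', hb', a', ha', hab.symm, hab'.symm, fun h => hne ⟨h.2, h.1⟩⟩

lemma exists_adj_of_not_bridge {G : SimpleGraph V} (hb : ∀ e ∈ G.edgeSet, ¬G.IsBridge e)
    {X : Set V} {a b : V} (ha : a ∈ X) (hbX : b ∉ X) (hab : G.Adj a b) :
    ∃ a' ∈ X, ∃ b' ∉ X, G.Adj a' b' ∧ ¬(a' = a ∧ b' = b) := by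
  have h := hb s(a, b) hab
  rw [isBridge_iff, not_not] at h
  obtain ⟨p⟩ := h
  obtain ⟨d, -, h1, h2⟩ := p.exists_boundary_dart X ha hbX
  have hd := d.adj
  rw [deleteEdges_adj] at hd
  refine ⟨d.fst, h1, d.snd, h2, hd.1, fun h => hd.2 ?_⟩
  rw [h.1, h.2]
  rfl

/-- A minimal nonempty subset `X` of `Y` among those joined to the rest of `Y` by at most one
edge induces a 2-edge-connected subgraph. -/
lemma twoEdgesBetween_of_minimal {G : SimpleGraph V} {X Y : Set V}
    (hX : Minimal (fun X => X.Nonempty ∧ X ⊆ Y ∧ ¬TwoEdgesBetween G X (Y \ X)) X)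
    {W : Set V} (hW : W.Nonempty) (hWX : W ⊂ X) : TwoEdgesBetween G W (X \ W) := by
  by_contra hcon
  have hXY := hX.prop.2.1
  have key : ∀ W' : Set V, W'.Nonempty → W' ⊂ X → ¬TwoEdgesBetween G W' (X \ W') →
      ∃ a ∈ W', ∃ b ∈ Y \ X, G.Adj a b := by
    intro W' hne hss htwo
    by_contra! hno
    refine hss.2 (hX.le_of_le ⟨hne, hss.1.trans hXY, fun h => htwo ?_⟩ hss.1)
    obtain ⟨a, ha, b, hb, a', ha', b', hb', hab, hab', hne'⟩ := h
    have aux : ∀ x ∈ W', ∀ y ∈ Y \ W', G.Adj x y → y ∈ X \ W' := fun x hx y hy hxy =>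
      ⟨by_contra fun h => hno x hx y ⟨hy.1, h⟩ hxy, hy.2⟩
    exact ⟨a, ha, b, aux a ha b hb hab, a', ha', b', aux a' ha' b' hb' hab', hab, hab', hne'⟩
  obtain ⟨a, ha, b, hb, hab⟩ := key W hW hWX hcon
  obtain ⟨x, hx, hxW⟩ := Set.exists_of_ssubset hWX
  obtain ⟨w, hw⟩ := hW
  obtain ⟨a', ha', b', hb', hab'⟩ := key (X \ W) ⟨x, hx, hxW⟩
    ⟨Set.sdiff_subset, fun h => (h (hWX.1 hw)).2 hw⟩ (by
      rw [Set.sdiff_sdiff_cancel_left hWX.1]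
      exact fun h => hcon h.symm)
  exact hX.prop.2.2 ⟨a, hWX.1 ha, b, hb, a', ha'.1, b', hb', hab, hab',
    fun h => ha'.2 (h.1 ▸ ha)⟩

end Cuts

section Trails

variable {V : Type*} {H : SimpleGraph V}

/-- Rerouting a closed trail through an ear. -/
lemma isTrail_reroute {x z h : V} {A : H.Walk x z} {B : H.Walk z x} {P : H.Walk z h}
    (hAB : (A.append B).IsTrail) (hP : P.IsTrail)
    (hdisj : ∀ e ∈ P.edges, e ∉ A.edges ∧ e ∉ B.edges) (hh : h ∈ B.support) :
    ∃ T : H.Walk x x, T.IsTrail ∧ ∀ y ∈ P.support, y ∈ T.support := by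
  classical
  refine ⟨A.append (P.append (B.dropUntil h hh)), ?_, fun y hy => ?_⟩
  · have hsub := B.edges_dropUntil_subset_edges hh
    have hB := (B.edges_dropUntil_suffix_edges hh).sublist
    rw [Walk.isTrail_def, Walk.edges_append, List.nodup_append'] at hAB
    simp only [Walk.isTrail_def, Walk.edges_append, List.nodup_append', List.disjoint_append_right]
    exact ⟨hAB.1, ⟨hP.edges_nodup, hAB.2.1.sublist hB, fun e h1 h2 => (hdisj e h1).2 (hsub h2)⟩,
      fun e h1 h2 => (hdisj e h2).1 h1, fun e h1 h2 => hAB.2.2 h1 (hsub h2)⟩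
  · simp [Walk.mem_support_append_iff, hy]

/-- In a 2-edge-connected graph, any two vertices lie on a common closed trail. -/
lemma exists_closed_trail [Finite V] {G : SimpleGraph V} {X : Set V}
    (hX : ∀ W : Set V, W.Nonempty → W ⊂ X → TwoEdgesBetween G W (X \ W))
    (hGH : ∀ a ∈ X, ∀ b ∈ X, G.Adj a b → H.Adj a b) (hHX : ∀ a b, H.Adj a b → b ∈ X)
    {x y : V} (hx : x ∈ X) (hy : y ∈ X) : ∃ T : H.Walk x x, T.IsTrail ∧ y ∈ T.support := by
  classical
  let R : Set V := {v ∈ X | ∃ T : H.Walk x x, T.IsTrail ∧ v ∈ T.support}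
  have hxR : x ∈ R := ⟨hx, Walk.nil, by simp, by simp⟩
  by_contra hyR
  have hRX : R ⊂ X := ⟨fun v hv => hv.1, fun h => hyR (h hy).2⟩
  obtain ⟨z, hz, w, hw, -, -, -, -, hzw, -, -⟩ := hX R ⟨x, hxR⟩ hRX
  obtain ⟨hzX, T, hT, hzT⟩ := hz
  have hTX : ∀ v ∈ T.support, v ∈ X := fun v hv => by
    by_cases hvx : v = x
    · exact hvx ▸ hx
    · obtain ⟨e, he, hve⟩ := (Walk.mem_support_iff_exists_mem_edges.1 hv).resolve_left hvx
      induction e with | h p q =>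
      have hpq := T.adj_of_mem_edges he
      rcases Sym2.mem_iff.1 hve with rfl | rfl
      · exact hHX _ _ hpq.symm
      · exact hHX _ _ hpq
  have hwT : w ∉ T.support := fun h => hw.2 ⟨hw.1, T, hT, h⟩
  let H' : SimpleGraph V :=
    { Adj := fun u v => H.Adj u v ∧ u ∉ T.support ∧ v ∉ T.support
      symm := ⟨fun u v h => ⟨h.1.symm, h.2.2, h.2.1⟩⟩
      loopless := ⟨fun u h => h.1.ne rfl⟩ }
  have hH' : H' ≤ H := fun _ _ h => h.1
  let W : Set V := {v ∈ X | v ∉ T.support ∧ H'.Reachable w v}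
  have hWX : W ⊂ X := ⟨fun v hv => hv.1, fun h => (h hzX).2.1 hzT⟩
  obtain ⟨a, ha, b, hb, hab, hne⟩ :
      ∃ a ∈ W, ∃ b ∈ X \ W, G.Adj a b ∧ ¬(a = w ∧ b = z) := by
    obtain ⟨a, ha, b, hb, a', ha', b', hb', hab, hab', hne⟩ :=
      hX W ⟨w, hw.1, hwT, .rfl⟩ hWX
    by_cases h : a = w ∧ b = z
    · exact ⟨a', ha', b', hb', hab', fun h' => hne ⟨h'.1.trans h.1.symm, h'.2.trans h.2.symm⟩⟩
    · exact ⟨a, ha, b, hb, hab, h⟩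
  have habH : H.Adj a b := hGH a ha.1 b hb.1 hab
  have hbT : b ∈ T.support := by
    by_contra hbT
    exact hb.2 ⟨hb.1, hbT, ha.2.2.trans (Adj.reachable (G := H') ⟨habH, ha.2.1, hbT⟩)⟩
  obtain ⟨q, hq⟩ := ha.2.2.exists_isPath
  have hqT : ∀ u v, s(u, v) ∈ q.edges → u ∉ T.support ∧ v ∉ T.support :=
    fun u v h => (q.adj_of_mem_edges h).2
  let P : H.Walk z b := .cons (hGH z hzX w hw.1 hzw) ((q.mapLe hH').concat habH)
  have hPe : P.edges = s(z, w) :: (q.edges ++ [s(a, b)]) := by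
    simp [P, Walk.edges_concat]
  have hP : P.IsTrail := by
    rw [Walk.isTrail_def, hPe]
    have h1 : s(z, w) ∉ q.edges := fun h => (hqT _ _ h).1 hzT
    have h2 : s(a, b) ∉ q.edges := fun h => (hqT _ _ h).2 hbT
    have h3 : s(z, w) ≠ s(a, b) := fun h => by
      rcases Sym2.eq_iff.1 h with ⟨rfl, rfl⟩ | ⟨rfl, rfl⟩
      · exact ha.2.1 hzT
      · exact hne ⟨rfl, rfl⟩
    have h4 := hq.isTrail.edges_nodup
    simp only [List.nodup_cons, List.mem_append, List.mem_singleton, not_or,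
      List.nodup_append', List.nodup_nil, List.disjoint_singleton, List.not_mem_nil,
      not_false_eq_true, and_true]
    exact ⟨⟨h1, h3⟩, h4, trivial, h2⟩
  have hPT : ∀ e ∈ P.edges, e ∉ T.edges := by
    intro e he heT
    rw [hPe, List.mem_cons, List.mem_append, List.mem_singleton] at he
    rcases he with rfl | he | rfl
    · exact hwT (T.snd_mem_support_of_mem_edges heT)
    · induction e with | h u v =>
      exact (hqT u v he).1 (T.fst_mem_support_of_mem_edges heT)
    · exact ha.2.1 (T.fst_mem_support_of_mem_edges heT)
  have hwP : w ∈ P.support := by simp [P]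
  set A := T.takeUntil z hzT with hA
  set B := T.dropUntil z hzT with hB
  have hspec : A.append B = T := T.take_spec hzT
  have hAe : ∀ e ∈ P.edges, e ∉ A.edges ∧ e ∉ B.edges := fun e he => by
    have := hPT e he
    rw [← hspec, Walk.edges_append, List.mem_append, not_or] at this
    exact this
  obtain ⟨T', hT', hPT'⟩ : ∃ T' : H.Walk x x, T'.IsTrail ∧ ∀ y ∈ P.support, y ∈ T'.support := by
    rw [← hspec, Walk.mem_support_append_iff] at hbT
    rcases hbT with hbA | hbB
    · refine isTrail_reroute (A := B.reverse) (B := A.reverse) (P := P) ?_ hP ?_ (by simpa)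
      · rw [← Walk.reverse_append, hspec]
        exact hT.reverse
      · intro e he
        simpa [and_comm] using hAe e he
    · exact isTrail_reroute (hspec ▸ hT) hP hAe hbB
  exact hw.2 ⟨hw.1, T', hT', hPT' w hwP⟩

end Trails

section SixFlow

variable {V : Type*} {G K : SimpleGraph V} {U : Set V}

lemma sup_edge_adj_iff (K : SimpleGraph V) {a b : V} (hab : a ≠ b) (u v : V) :
    (K ⊔ edge a b).Adj u v ↔ K.Adj u v ∨ s(u, v) = s(a, b) := by
  rw [sup_adj, edge_adj, Sym2.eq_iff]
  refine or_congr_right (and_iff_left_of_imp ?_)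
  rintro (⟨rfl, rfl⟩ | ⟨rfl, rfl⟩)
  exacts [hab, hab.symm]

/-- A subgraph `K` of `G` on the vertex set `U` which connects all pairs of vertices of `U` that
are connected in `G`. -/
structure IsGrounded (G : SimpleGraph V) (U : Set V) (K : SimpleGraph V) : Prop where
  le : K ≤ G
  mem : ∀ u v, K.Adj u v → u ∈ U
  reachable : ∀ u ∈ U, ∀ v ∈ U, G.Reachable u v → K.Reachable u v

lemma IsGrounded.reachable_of_extension (h : IsGrounded G U K) {U' : Set V} {K' : SimpleGraph V}
    (hK' : K' ≤ G) (hKK' : K ≤ K') (hU' : ∀ u ∈ U', ∃ u₀ ∈ U, K'.Reachable u u₀) :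
    ∀ u ∈ U', ∀ v ∈ U', G.Reachable u v → K'.Reachable u v := by
  intro u hu v hv huv
  obtain ⟨u₀, hu₀, hr⟩ := hU' u hu
  obtain ⟨v₀, hv₀, hs⟩ := hU' v hv
  exact hr.trans (((h.reachable u₀ hu₀ v₀ hv₀
    ((hr.mono hK').symm.trans (huv.trans (hs.mono hK')))).mono hKK').trans hs.symm)

lemma exists_not_three_dvd_add (m n : ℤ) : ∃ t : ℤ, ¬(3 : ℤ) ∣ m + t ∧ ¬(3 : ℤ) ∣ n + t := by
  by_contra! h
  have h0 := h 0
  have h1 := h 1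
  have h2 := h 2
  omega

variable [Fintype V]

/-- A `2`-flow `f` vanishing at `U` and an integer flow `g` such that each edge of `G` outside
`K` is in the support of `f` or has a value of `g` not divisible by `3`. -/
structure IsFlowPair (G : SimpleGraph V) (U : Set V) (K : SimpleGraph V) (f g : V → V → ℤ) :
    Prop where
  left : IsIntFlow G f
  right : IsIntFlow G g
  abs_le : ∀ u v, |f u v| ≤ 1
  eq_zero : ∀ u ∈ U, ∀ v, f u v = 0
  ne_zero : ∀ u v, G.Adj u v → ¬K.Adj u v → f u v ≠ 0 ∨ ¬(3 : ℤ) ∣ g u v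

/-- `(U, K)` can be enlarged such that flow pairs can be pulled back along the enlargement. -/
def HasExtension (G : SimpleGraph V) (U : Set V) (K : SimpleGraph V) : Prop :=
  ∃ U' K', IsGrounded G U' K' ∧ (U, K) < (U', K') ∧
    ((∃ f g, IsFlowPair G U' K' f g) → ∃ f g, IsFlowPair G U K f g)

lemma IsIntFlow.dvd_comm {g : V → V → ℤ} (hg : IsIntFlow G g) {k : ℤ} {u v : V} :
    k ∣ g u v ↔ k ∣ g v u := by
  rw [hg.antisymm, dvd_neg]

/-- An edge joining two vertices of `U` can be added. -/
lemma IsGrounded.hasExtension_of_adj (h : IsGrounded G U K) {a b : V} (ha : a ∈ U) (hb : b ∈ U)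
    (hab : G.Adj a b) (hK : ¬K.Adj a b) : HasExtension G U K := by
  classical
  have hadj := sup_edge_adj_iff K hab.ne
  refine ⟨U, K ⊔ edge a b, ⟨?_, ?_, ?_⟩, ?_, ?_⟩
  · refine sup_le h.le ?_
    rw [edge_le_iff]
    exact Or.inr hab
  · intro u v huv
    rcases (hadj u v).1 huv with huv | huv
    · exact h.mem u v huv
    · rcases Sym2.eq_iff.1 huv with ⟨rfl, rfl⟩ | ⟨rfl, rfl⟩ <;> assumption
  · exact fun u hu v hv huv => (h.reachable u hu v hv huv).mono le_sup_left
  · refine lt_of_le_of_ne ⟨le_rfl, le_sup_left⟩ fun heq => hK ?_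
    rw [show K = K ⊔ edge a b from congrArg Prod.snd heq]
    exact (hadj a b).2 (Or.inr rfl)
  · rintro ⟨f, g, hfg⟩
    obtain ⟨p⟩ := h.reachable b hb a ha hab.reachable.symm
    let c : V → V → ℤ := fun x y => dartFlow a b x y + walkFlow p x y
    have hc : IsIntFlow G c := by
      refine ⟨fun u v => ?_, fun u v huv => ?_, fun v => ?_⟩
      · simp only [c, dartFlow_antisymm _ _ u v, walkFlow_antisymm p u v]; ring
      · have h1 : s(u, v) ≠ s(a, b) := fun h' => huv (by
          rw [← mem_edgeSet, h']; exact hab)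
        simp only [c, dartFlow_eq_zero h1,
          walkFlow_eq_zero_of_not_adj p fun h' => huv (h.le h'), add_zero]
      · simp only [c, Finset.sum_add_distrib, sum_dartFlow, sum_walkFlow]; ring
    have hcab : c a b = 1 := by
      simp only [c, dartFlow_self hab.ne, walkFlow_eq_zero_of_not_adj p hK, add_zero]
    obtain ⟨t, ht, -⟩ := exists_not_three_dvd_add (g a b) (g a b)
    have hg : IsIntFlow G (fun u v => g u v + t * c u v) := hfg.right.add (hc.const_mul t)
    refine ⟨f, _, hfg.left, hg, hfg.abs_le, hfg.eq_zero, fun u v huv hKuv => ?_⟩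
    by_cases he : s(u, v) = s(a, b)
    · right
      rcases Sym2.eq_iff.1 he with ⟨rfl, rfl⟩ | ⟨rfl, rfl⟩
      · rwa [hcab, mul_one]
      · rwa [hg.dvd_comm, hcab, mul_one]
    · have h0 : c u v = 0 := by
        simp only [c, dartFlow_eq_zero he, walkFlow_eq_zero_of_not_adj p hKuv, add_zero]
      rw [h0, mul_zero, add_zero]
      exact hfg.ne_zero u v huv fun h' => ((hadj u v).1 h').elim hKuv he

/-- A union of components of `G` disjoint from `U` provides an additional vertex. -/
lemma IsGrounded.hasExtension_of_isolated (h : IsGrounded G U K) {X : Set V} (hXU : Disjoint X U)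
    (hne : X.Nonempty) (hX : ∀ a ∈ X, ∀ b ∉ X, ¬G.Adj a b) : HasExtension G U K := by
  obtain ⟨x, hx⟩ := hne
  have hno : ∀ u ∈ U, ¬G.Reachable x u := by
    rintro u hu ⟨p⟩
    obtain ⟨d, -, h1, h2⟩ := p.exists_boundary_dart X hx fun h' => hXU.le_bot ⟨h', hu⟩
    exact hX _ h1 _ h2 d.adj
  refine ⟨insert x U, K, ⟨h.le, fun u v huv => Or.inr (h.mem u v huv), ?_⟩, ?_, ?_⟩
  · rintro u (rfl | hu) v (rfl | hv) huv
    · exact .rfl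
    · exact (hno v hv huv).elim
    · exact (hno u hu huv.symm).elim
    · exact h.reachable u hu v hv huv
  · refine lt_of_le_of_ne ⟨Set.subset_insert x U, le_rfl⟩ fun heq => ?_
    have : x ∈ U := by
      rw [show U = insert x U from congrArg Prod.fst heq]
      exact Set.mem_insert x U
    exact hno x this .rfl
  · rintro ⟨f, g, hfg⟩
    exact ⟨f, g, hfg.left, hfg.right, hfg.abs_le, fun u hu => hfg.eq_zero u (Or.inr hu),
      hfg.ne_zero⟩

/-- One edge of a 2-edge-cut leaving `U` can be added together with its end. -/
lemma IsGrounded.hasExtension_of_two_cut (h : IsGrounded G U K) {X : Set V} (hXU : Disjoint X U)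
    {a b a' b' : V} (ha : a ∈ X) (hb : b ∈ U) (hab : G.Adj a b)
    (ha' : a' ∈ X) (hbX' : b' ∉ X) (hbU' : b' ∉ U) (hab' : G.Adj a' b')
    (honly : ∀ x ∈ X, ∀ y ∉ X, G.Adj x y → (x = a ∧ y = b) ∨ (x = a' ∧ y = b')) :
    HasExtension G U K := by
  classical
  have haU : a ∉ U := fun h' => hXU.le_bot ⟨ha, h'⟩
  have hbX : b ∉ X := fun h' => hXU.le_bot ⟨h', hb⟩
  have hadj := sup_edge_adj_iff K hab.ne
  have hle : K ⊔ edge a b ≤ G := by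
    refine sup_le h.le ?_
    rw [edge_le_iff]
    exact Or.inr hab
  refine ⟨insert a U, K ⊔ edge a b, ⟨hle, ?_, ?_⟩, ?_, ?_⟩
  · intro u v huv
    rcases (hadj u v).1 huv with huv | huv
    · exact Or.inr (h.mem u v huv)
    · rcases Sym2.eq_iff.1 huv with ⟨rfl, rfl⟩ | ⟨rfl, rfl⟩
      · exact Or.inl rfl
      · exact Or.inr hb
  · refine h.reachable_of_extension hle le_sup_left ?_
    rintro u (rfl | hu)
    · exact ⟨b, hb, Adj.reachable ((hadj _ _).2 (Or.inr rfl))⟩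
    · exact ⟨u, hu, .rfl⟩
  · refine lt_of_le_of_ne ⟨Set.subset_insert a U, le_sup_left⟩ fun heq => haU ?_
    rw [show U = insert a U from congrArg Prod.fst heq]
    exact Set.mem_insert a U
  · rintro ⟨f, g, hfg⟩
    have hcut : ∀ {c : V → V → ℤ}, IsIntFlow G c → c a b + c a' b' = 0 := by
      intro c hc
      rw [← hc.sum_cut (Finset.univ.filter (· ∈ X))]
      refine (Finset.sum_eq_add (f := fun p : V × V => c p.1 p.2) (a, b) (a', b') ?_ ?_ ?_ ?_).symm
      · exact fun heq => hbU' ((Prod.mk.inj heq).2 ▸ hb)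
      · rintro ⟨x, y⟩ hxy ⟨h1, h2⟩
        simp only [Finset.mem_product, Finset.mem_compl, Finset.mem_filter, Finset.mem_univ,
          true_and] at hxy
        refine hc.support x y fun hG => ?_
        rcases honly x hxy.1 y hxy.2 hG with ⟨rfl, rfl⟩ | ⟨rfl, rfl⟩
        exacts [h1 rfl, h2 rfl]
      · simp [ha, hbX]
      · simp [ha', hbX']
    have hf : f a' b' = 0 := by
      have := hcut hfg.left
      rwa [hfg.eq_zero a (Or.inl rfl), zero_add] at this
    have hg : ¬(3 : ℤ) ∣ g a b := by
      have h1 := (hfg.ne_zero a' b' hab' fun h' => ?_).resolve_left (not_not.2 hf)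
      · rwa [eq_neg_of_add_eq_zero_left (hcut hfg.right), dvd_neg]
      · rcases (hadj _ _).1 h' with h' | h'
        · exact hbU' (h.mem _ _ h'.symm)
        · rcases Sym2.eq_iff.1 h' with ⟨-, rfl⟩ | ⟨-, rfl⟩
          exacts [hbU' hb, hbX' ha]
    refine ⟨f, g, hfg.left, hfg.right, hfg.abs_le, fun u hu => hfg.eq_zero u (Or.inr hu),
      fun u v huv hK => ?_⟩
    by_cases he : s(u, v) = s(a, b)
    · right
      rcases Sym2.eq_iff.1 he with ⟨rfl, rfl⟩ | ⟨rfl, rfl⟩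
      · exact hg
      · rwa [hfg.right.dvd_comm]
    · exact hfg.ne_zero u v huv fun h' => ((hadj u v).1 h').elim hK he

/-- A closed trail outside `U` can be added together with two edges joining it to `U`. -/
lemma IsGrounded.hasExtension_of_trail (h : IsGrounded G U K) {a b a' b' : V} (hb : b ∈ U)
    (hb' : b' ∈ U) (hab : G.Adj a b) (hab' : G.Adj a' b') (hne : ¬(a' = a ∧ b' = b))
    {T : G.Walk a a} (hT : T.IsTrail) (ha' : a' ∈ T.support) (hTU : ∀ v ∈ T.support, v ∉ U) :
    HasExtension G U K := by
  classical
  have haT : a ∈ T.support := T.start_mem_support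
  have haU := hTU a haT
  have haU' := hTU a' ha'
  have hTe : ∀ {u v}, u ∈ U → s(u, v) ∉ T.edges :=
    fun hu h' => hTU _ (T.fst_mem_support_of_mem_edges h') hu
  let K' : SimpleGraph V := K ⊔ fromEdgeSet {e | e ∈ T.edges ∨ e = s(a, b) ∨ e = s(a', b')}
  have hKK' : K ≤ K' := le_sup_left
  have hadj : ∀ u v, K'.Adj u v ↔
      K.Adj u v ∨ s(u, v) ∈ T.edges ∨ s(u, v) = s(a, b) ∨ s(u, v) = s(a', b') := by
    intro u v
    simp only [K', sup_adj, fromEdgeSet_adj, Set.mem_ofPred_eq]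
    refine or_congr_right (and_iff_left_of_imp ?_)
    rintro (h' | h' | h')
    · exact (T.adj_of_mem_edges h').ne
    · rintro rfl; exact hab.ne (by rcases Sym2.eq_iff.1 h' with ⟨rfl, h⟩ | ⟨rfl, h⟩ <;> simp [h])
    · rintro rfl; exact hab'.ne (by rcases Sym2.eq_iff.1 h' with ⟨rfl, h⟩ | ⟨rfl, h⟩ <;> simp [h])
  have hle : K' ≤ G := by
    intro u v huv
    rcases (hadj u v).1 huv with h' | h' | h' | h'
    · exact h.le h'
    · exact T.adj_of_mem_edges h'
    · rw [← mem_edgeSet, h']; exact hab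
    · rw [← mem_edgeSet, h']; exact hab'
  have hTK' : ∀ {u v} (q : G.Walk u v), (∀ e ∈ q.edges, e ∈ T.edges) → K'.Reachable u v :=
    fun q hq => ⟨q.transfer K' fun e he => by
      induction e with | h x y => exact (hadj x y).2 (Or.inr (Or.inl (hq _ he)))⟩
  refine ⟨U ∪ {v | v ∈ T.support}, K', ⟨hle, ?_, ?_⟩, ?_, ?_⟩
  · intro u v huv
    rcases (hadj u v).1 huv with h' | h' | h' | h'
    · exact Or.inl (h.mem u v h')
    · exact Or.inr (T.fst_mem_support_of_mem_edges h')
    · rcases Sym2.eq_iff.1 h' with ⟨rfl, rfl⟩ | ⟨rfl, rfl⟩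
      exacts [Or.inr haT, Or.inl hb]
    · rcases Sym2.eq_iff.1 h' with ⟨rfl, rfl⟩ | ⟨rfl, rfl⟩
      exacts [Or.inr ha', Or.inl hb']
  · refine h.reachable_of_extension hle hKK' ?_
    rintro u (hu | hu)
    · exact ⟨u, hu, .rfl⟩
    · exact ⟨b, hb, (hTK' (T.takeUntil u hu) fun e he =>
        T.edges_takeUntil_subset_edges hu he).symm.trans
          (Adj.reachable ((hadj _ _).2 (Or.inr (Or.inr (Or.inl rfl)))))⟩
  · refine lt_of_le_of_ne ⟨Set.subset_union_left, hKK'⟩ fun heq => haU ?_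
    rw [show U = U ∪ {v | v ∈ T.support} from congrArg Prod.fst heq]
    exact Or.inr haT
  · rintro ⟨f, g, hfg⟩
    let Q := T.takeUntil a' ha'
    have hQT : ∀ {e}, e ∈ Q.edges → e ∈ T.edges := fun he => T.edges_takeUntil_subset_edges ha' he
    obtain ⟨p⟩ := h.reachable b' hb' b hb (hab'.reachable.symm.trans
      (Q.reachable.symm.trans hab.reachable))
    let c : V → V → ℤ := fun x y =>
      dartFlow b a x y + walkFlow Q x y + dartFlow a' b' x y + walkFlow p x y
    have hcoff : ∀ u v, ¬K'.Adj u v → c u v = 0 := by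
      intro u v huv
      rw [hadj, not_or, not_or, not_or] at huv
      have h1 : s(u, v) ≠ s(b, a) := by rw [Sym2.eq_swap (a := b)]; exact huv.2.2.1
      simp only [c, dartFlow_eq_zero h1, dartFlow_eq_zero huv.2.2.2,
        walkFlow_eq_zero Q fun h' => huv.2.1 (hQT h'), walkFlow_eq_zero_of_not_adj p huv.1,
        add_zero]
    have hc : IsIntFlow G c := by
      refine ⟨fun u v => ?_, fun u v huv => hcoff u v fun h' => huv (hle h'), fun v => ?_⟩
      · simp only [c, dartFlow_antisymm _ _ u v, walkFlow_antisymm _ u v]; ring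
      · simp only [c, Finset.sum_add_distrib, sum_dartFlow, sum_walkFlow]; ring
    have hcab : c b a = 1 := by
      have h1 : s(b, a) ≠ s(a', b') := fun h' => by
        rcases Sym2.eq_iff.1 h' with ⟨rfl, -⟩ | ⟨rfl, rfl⟩
        exacts [haU' hb, hne ⟨rfl, rfl⟩]
      simp only [c, dartFlow_self hab.ne', dartFlow_eq_zero h1,
        walkFlow_eq_zero Q fun h' => hTe hb (hQT h'),
        walkFlow_eq_zero_of_not_adj p fun h' => haU (h.mem _ _ h'.symm), add_zero]
    have hcab' : c a' b' = 1 := by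
      have h1 : s(a', b') ≠ s(b, a) := fun h' => by
        rcases Sym2.eq_iff.1 h' with ⟨rfl, -⟩ | ⟨rfl, rfl⟩
        exacts [haU' hb, hne ⟨rfl, rfl⟩]
      simp only [c, dartFlow_self hab'.ne, dartFlow_eq_zero h1,
        walkFlow_eq_zero Q fun h' => hTe hb' (Sym2.eq_swap (a := a') ▸ hQT h'),
        walkFlow_eq_zero_of_not_adj p fun h' => haU' (h.mem _ _ h'), add_zero, zero_add]
    obtain ⟨t, ht, ht'⟩ := exists_not_three_dvd_add (g b a) (g a' b')
    have hg : IsIntFlow G (fun u v => g u v + t * c u v) := hfg.right.add (hc.const_mul t)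
    have hT0 : ∀ {u v}, s(u, v) ∈ T.edges → f u v = 0 := fun h' =>
      hfg.eq_zero _ (Or.inr (T.fst_mem_support_of_mem_edges h')) _
    refine ⟨_, _, hfg.left.add (isIntFlow_walkFlow le_rfl T), hg, fun u v => ?_,
      fun u hu v => ?_, fun u v huv hK => ?_⟩
    · by_cases he : s(u, v) ∈ T.edges
      · rcases walkFlow_of_isTrail hT he with ⟨h1, -⟩ | ⟨h1, -⟩ <;> simp [h1, hT0 he]
      · rw [walkFlow_eq_zero T he, add_zero]
        exact hfg.abs_le u v
    · rw [hfg.eq_zero u (Or.inl hu), walkFlow_eq_zero T (hTe hu), add_zero]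
    · by_cases he : s(u, v) ∈ T.edges
      · left
        rcases walkFlow_of_isTrail hT he with ⟨h1, -⟩ | ⟨h1, -⟩ <;> simp [h1, hT0 he]
      by_cases he1 : s(u, v) = s(a, b)
      · right
        rcases Sym2.eq_iff.1 he1 with ⟨rfl, rfl⟩ | ⟨rfl, rfl⟩
        · rwa [hg.dvd_comm, hcab, mul_one]
        · rwa [hcab, mul_one]
      by_cases he2 : s(u, v) = s(a', b')
      · right
        rcases Sym2.eq_iff.1 he2 with ⟨rfl, rfl⟩ | ⟨rfl, rfl⟩
        · rwa [hcab', mul_one]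
        · rwa [hg.dvd_comm, hcab', mul_one]
      have hK' : ¬K'.Adj u v := by
        rw [hadj]; tauto
      rw [walkFlow_eq_zero T he, hcoff u v hK', mul_zero, add_zero, add_zero]
      exact hfg.ne_zero u v huv hK'

lemma IsGrounded.hasExtension (hb : ∀ e ∈ G.edgeSet, ¬G.IsBridge e) (h : IsGrounded G U K)
    (hU : U ≠ Set.univ) : HasExtension G U K := by
  have hYne : Uᶜ.Nonempty := Set.nonempty_compl.2 hU
  obtain ⟨X, -, hX⟩ := exists_minimal_le_of_wellFoundedLT
    (fun X => X.Nonempty ∧ X ⊆ Uᶜ ∧ ¬TwoEdgesBetween G X (Uᶜ \ X)) Uᶜ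
    ⟨hYne, le_rfl, by rintro ⟨a, -, b, hb, -⟩; exact hb.2 hb.1⟩
  have hXU : Disjoint X U := Set.disjoint_left.2 fun x hx => hX.prop.2.1 hx
  by_cases htwo : TwoEdgesBetween G X U
  · obtain ⟨a, ha, b, hb, a', ha', b', hb', hab, hab', hne⟩ := htwo
    let H : SimpleGraph V :=
      { Adj := fun u v => G.Adj u v ∧ u ∈ X ∧ v ∈ X
        symm := ⟨fun u v h => ⟨h.1.symm, h.2.2, h.2.1⟩⟩
        loopless := ⟨fun u h => h.1.ne rfl⟩ }
    have hH : H ≤ G := fun _ _ h => h.1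
    obtain ⟨T, hT, haT'⟩ := exists_closed_trail (H := H)
      (fun W hW hWX => twoEdgesBetween_of_minimal hX hW hWX)
      (fun u hu v hv huv => ⟨huv, hu, hv⟩) (fun _ _ h => h.2.2) ha ha'
    have hTX : ∀ v ∈ T.support, v ∈ X := fun v hv => by
      rcases Walk.mem_support_iff_exists_mem_edges.1 hv with rfl | ⟨e, he, hve⟩
      · exact ha
      · induction e with | h p q =>
        have hpq := T.adj_of_mem_edges he
        rcases Sym2.mem_iff.1 hve with rfl | rfl
        exacts [hpq.2.1, hpq.2.2]
    exact h.hasExtension_of_trail hb hb' hab hab' hne (T := T.mapLe hH) (hT.mapLe hH) (by simpa)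
      fun v hv => hX.prop.2.1 (hTX v (by simpa using hv))
  by_cases hone : ∃ a ∈ X, ∃ b ∈ U, G.Adj a b
  · obtain ⟨a, ha, b, hbU, hab⟩ := hone
    have hU1 : ∀ x ∈ X, ∀ y ∈ U, G.Adj x y → x = a ∧ y = b := fun x hx y hy hxy =>
      by_contra fun hne => htwo ⟨a, ha, b, hbU, x, hx, y, hy, hab, hxy, hne⟩
    obtain ⟨a', ha', b', hb', hab', hne⟩ :=
      exists_adj_of_not_bridge hb ha (fun h' => hXU.le_bot ⟨h', hbU⟩) hab
    have hbU' : b' ∉ U := fun h' => hne (hU1 a' ha' b' h' hab')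
    refine h.hasExtension_of_two_cut hXU ha hbU hab ha' hb' hbU' hab' fun x hx y hy hxy => ?_
    by_cases hyU : y ∈ U
    · exact Or.inl (hU1 x hx y hyU hxy)
    · exact Or.inr (by_contra fun hne => hX.prop.2.2
        ⟨a', ha', b', ⟨hbU', hb'⟩, x, hx, y, ⟨hyU, hy⟩, hab', hxy, hne⟩)
  · refine h.hasExtension_of_isolated hXU hX.prop.1 fun a ha b hbX hab => ?_
    have hout : ∀ x ∈ X, ∀ y ∉ X, G.Adj x y → y ∈ Uᶜ \ X := fun x hx y hy hxy =>
      ⟨fun hyU => hone ⟨x, hx, y, hyU, hxy⟩, hy⟩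
    obtain ⟨a', ha', b', hb', hab', hne⟩ := exists_adj_of_not_bridge hb ha hbX hab
    exact hX.prop.2.2 ⟨a, ha, b, hout a ha b hbX hab, a', ha', b', hout a' ha' b' hb' hab',
      hab, hab', hne⟩

lemma IsGrounded.exists_isFlowPair (hb : ∀ e ∈ G.edgeSet, ¬G.IsBridge e)
    (h : IsGrounded G U K) : ∃ f g, IsFlowPair G U K f g := by
  induction hp : (U, K) using WellFoundedGT.induction generalizing U K with
  | ind p ih =>
  subst hp
  by_cases hext : HasExtension G U K
  · obtain ⟨U', K', hG, hlt, himp⟩ := hext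
    exact himp (ih _ hlt hG rfl)
  · have hU : U = Set.univ := by_contra fun hU => hext (h.hasExtension hb hU)
    refine ⟨_, _, .zero G, .zero G, by simp, by simp, fun u v huv hK => ?_⟩
    exact (hext (h.hasExtension_of_adj (hU ▸ Set.mem_univ u) (hU ▸ Set.mem_univ v) huv hK)).elim

/-- **Seymour's 6-flow theorem**. -/
theorem exists_six_flow (hb : ∀ e ∈ G.edgeSet, ¬G.IsBridge e) :
    ∃ f, IsIntFlow G f ∧ ∀ u v, G.Adj u v → 1 ≤ |f u v| ∧ |f u v| ≤ 5 := by
  obtain ⟨f, g, hfg⟩ := IsGrounded.exists_isFlowPair (U := ∅) (K := ⊥) hb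
    ⟨bot_le, by simp, by simp⟩
  obtain ⟨g', hg', hgg', hlt⟩ := hfg.right.exists_abs_lt (k := 3) (by norm_num)
  refine ⟨_, (hfg.left.const_mul 3).add hg', fun u v huv => ?_⟩
  have h1 := hfg.abs_le u v
  have h2 := hfg.ne_zero u v huv (by simp)
  have h3 := hgg' u v
  have h4 := hlt u v
  grind

end SixFlow

section FlowNumber

variable {V : Type*} [Fintype V]

lemma hasNZF_six {G : SimpleGraph V} {d : ℕ} (hd : 0 < d)
    (hb : ∀ e ∈ G.edgeSet, ¬G.IsBridge e) : HasNZF G 6 d := by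
  obtain ⟨f, hf, hf5⟩ := exists_six_flow hb
  refine ⟨fun u v => (f u v : ℝ) • EuclideanSpace.single ⟨0, hd⟩ 1, ⟨fun u v => ?_, fun u v h => ?_,
    fun v => ?_⟩, fun u v h => ?_⟩
  · simp only
    rw [hf.antisymm u v, Int.cast_neg, neg_smul]
  · simp only
    rw [hf.support u v h, Int.cast_zero, zero_smul]
  · rw [← Finset.sum_smul, ← Int.cast_sum, hf.conserved, Int.cast_zero, zero_smul]
  · rw [norm_smul, PiLp.norm_single, norm_one, mul_one, Real.norm_eq_abs,
      ← Int.cast_abs]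
    obtain ⟨h1, h2⟩ := hf5 u v h
    constructor
    · exact_mod_cast h1
    · norm_num
      exact_mod_cast h2

lemma isClosed_isFlow (G : SimpleGraph V) (d : ℕ) :
    IsClosed {f : V → V → EuclideanSpace ℝ (Fin d) | IsFlow G f} := by
  simp only [IsFlow, Set.ofPred_and, Set.ofPred_forall]
  refine ((isClosed_iInter fun u => isClosed_iInter fun v => ?_).inter
    ((isClosed_iInter fun u => isClosed_iInter fun v => isClosed_iInter fun _ => ?_).inter
      (isClosed_iInter fun v => ?_)))
  all_goals exact isClosed_eq (by fun_prop) (by fun_prop)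

/-- The admissible values of `r` up to `R` form a compact set. -/
lemma isCompact_setOf_hasNZF (G : SimpleGraph V) (d : ℕ) (R : ℝ) :
    IsCompact {r : ℝ | (2 ≤ r ∧ r ≤ R) ∧ HasNZF G r d} := by
  let E := V → V → EuclideanSpace ℝ (Fin d)
  let S : Set (E × ℝ) := {p | (2 ≤ p.2 ∧ p.2 ≤ R) ∧ IsFlow G p.1 ∧
    ∀ u v, G.Adj u v → ‖p.1 u v‖ ∈ Set.Icc (1 : ℝ) (p.2 - 1)}
  have himg : {r : ℝ | (2 ≤ r ∧ r ≤ R) ∧ HasNZF G r d} = Prod.snd '' S := by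
    ext r
    constructor
    · rintro ⟨hr, f, hf⟩
      exact ⟨(f, r), ⟨hr, hf⟩, rfl⟩
    · rintro ⟨⟨f, r⟩, ⟨hr, hf⟩, rfl⟩
      exact ⟨hr, f, hf⟩
  have hclosed : IsClosed S := by
    have h1 : IsClosed {p : E × ℝ | IsFlow G p.1} :=
      (isClosed_isFlow G d).preimage continuous_fst
    have h2 : IsClosed {p : E × ℝ | 2 ≤ p.2 ∧ p.2 ≤ R} :=
      isClosed_Icc.preimage continuous_snd
    have h3 : IsClosed {p : E × ℝ | ∀ u v, G.Adj u v → ‖p.1 u v‖ ∈ Set.Icc (1 : ℝ) (p.2 - 1)} := by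
      simp only [Set.ofPred_forall, Set.mem_Icc, Set.ofPred_and]
      refine isClosed_iInter fun u => isClosed_iInter fun v => isClosed_iInter fun _ => ?_
      exact (isClosed_le (by fun_prop) (by fun_prop)).inter
        (isClosed_le (by fun_prop) (by fun_prop))
    exact h2.inter (h1.inter h3)
  have hbdd : Bornology.IsBounded S := by
    refine (Metric.isBounded_closedBall (x := (0 : E × ℝ)) (r := |R|)).subset ?_
    rintro ⟨f, r⟩ ⟨⟨hr2, hrR⟩, hf, hn⟩
    have hR : |R| = R := abs_of_nonneg (by linarith)
    rw [mem_closedBall_zero_iff, hR, Prod.norm_mk, max_le_iff]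
    simp only at hr2 hrR hf hn
    constructor
    · refine (pi_norm_le_iff_of_nonneg (by linarith)).2 fun u =>
        (pi_norm_le_iff_of_nonneg (by linarith)).2 fun v => ?_
      by_cases huv : G.Adj u v
      · linarith [(hn u v huv).2]
      · rw [hf.2.1 u v huv, norm_zero]; linarith
    · rw [Real.norm_eq_abs, abs_of_nonneg (by linarith)]; exact hrR
  rw [himg]
  exact (Metric.isCompact_of_isClosed_isBounded hclosed hbdd).image continuous_snd

end FlowNumber

/-- For a bridgeless graph `G` and `d ≥ 1`, the `d`-dimensional flow number is attained
(there is a `(φ_d(G), d)`-NZF on `G`) and moreover `φ_d(G) ≤ 6`. -/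
theorem stmt18 {V : Type*} [Fintype V] (G : SimpleGraph V) (d : ℕ) (hd : 0 < d)
    (hb : ∀ e ∈ G.edgeSet, ¬ G.IsBridge e) :
    HasNZF G (flowNumber G d) d ∧ flowNumber G d ≤ 6 := by
  obtain ⟨r, ⟨⟨hr2, hr6⟩, hr⟩, hmin⟩ := (isCompact_setOf_hasNZF G d 6).exists_isLeast
    ⟨6, ⟨by norm_num, le_rfl⟩, hasNZF_six hd hb⟩
  have hleast : IsLeast {r : ℝ | 2 ≤ r ∧ HasNZF G r d} r := by
    refine ⟨⟨hr2, hr⟩, fun s hs => ?_⟩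
    rcases le_total s 6 with hs6 | hs6
    · exact hmin ⟨⟨hs.1, hs6⟩, hs.2⟩
    · exact hr6.trans hs6
  rw [flowNumber, hleast.csInf_eq]
  exact ⟨hr, hr6⟩
end
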